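/- Let k ≥ 1. For every permutation τ of {0,1,…,k} and every λ ∈ [2, 2k²]^k, one has F_τ(λ) ∈ [2, 2k²]^k; that is, the compact cube [2,2k²]^k is stable under each of the maps F_τ. -/

import Mathlib

open MeasureTheory ProbabilityTheory Real Finset

noncomputable section

/-- Density of the centred Gaussian law with variance `g`. -/
def Phi (g y : ℝ) : ℝ := (Real.sqrt (2 * Real.pi * g))⁻¹ * Real.exp (-(y ^ 2) / (2 * g))

/-- Partial sums: `xbar x j = x 0 + ⋯ + x (j-1)` (i.e. `x̄_j`), with `x̄_0 = 0`. -/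
def xbar {k : ℕ} (x : Fin k → ℝ) (j : Fin (k + 1)) : ℝ :=
  ∑ i : Fin k, if (i : ℕ) < (j : ℕ) then x i else 0

/-- The density `Ψ_g` of the gaps sequence of iterated Brownian motion. -/
def Psi {k : ℕ} (g x : Fin k → ℝ) : ℝ :=
  ∑ τ : Equiv.Perm (Fin (k + 1)), ∏ i : Fin k,
    Phi (g i) (xbar x (τ i.succ) - xbar x (τ i.castSucc))

/-- The gaps sequence of a `(k+1)`-tuple of reals. -/
def gaps {k : ℕ} (ℓ : Fin (k + 1) → ℝ) : Fin k → ℝ :=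
  fun i => ℓ (Tuple.sort ℓ i.succ) - ℓ (Tuple.sort ℓ i.castSucc)

/-- `E_{τ,i}`: the set of `j ∈ {1,…,k}` with `min(τ(j-1),τ(j)) < i ≤ max(τ(j-1),τ(j))`
(index `j : Fin k` represents `j+1`, `i : Fin k` represents `i+1`). -/
def Eset {k : ℕ} (τ : Equiv.Perm (Fin (k + 1))) (i : Fin k) : Finset (Fin k) :=
  Finset.univ.filter (fun j : Fin k =>
    min ((τ j.castSucc : Fin (k + 1)) : ℕ) ((τ j.succ : Fin (k + 1)) : ℕ) < (i : ℕ) + 1 ∧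
      (i : ℕ) + 1 ≤ max ((τ j.castSucc : Fin (k + 1)) : ℕ) ((τ j.succ : Fin (k + 1)) : ℕ))

/-- `F_{τ,i}(λ) = Σ_{j ∈ E_{τ,i}} √(2 λ_j)`. -/
def F {k : ℕ} (τ : Equiv.Perm (Fin (k + 1))) (i : Fin k) (l : Fin k → ℝ) : ℝ :=
  ∑ j ∈ Eset τ i, Real.sqrt (2 * l j)

/-- `w_τ(λ) = 2^{-k} Π_i √(2 λ_i) / F_{τ,i}(λ)`. -/
def w {k : ℕ} (τ : Equiv.Perm (Fin (k + 1))) (l : Fin k → ℝ) : ℝ :=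
  (2 : ℝ)⁻¹ ^ k * ∏ i : Fin k, Real.sqrt (2 * l i) / F τ i l

theorem Eset_nonempty {k : ℕ} (τ : Equiv.Perm (Fin (k + 1))) (i : Fin k) :
    (Eset τ i).Nonempty := by
  by_contra h
  have step : ∀ j : Fin k,
      ((i : ℕ) + 1 ≤ (τ j.castSucc : ℕ) ↔ (i : ℕ) + 1 ≤ (τ j.succ : ℕ)) := by
    intro j
    have hj : j ∉ Eset τ i := fun hj => h ⟨j, hj⟩
    simp only [Eset, Finset.mem_filter, Finset.mem_univ, true_and] at hj
    omega
  have const : ∀ j : Fin (k + 1), ((i : ℕ) + 1 ≤ (τ j : ℕ) ↔ (i : ℕ) + 1 ≤ (τ 0 : ℕ)) := by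
    intro j
    induction j using Fin.induction with
    | zero => rfl
    | succ j ih => exact (step j).symm.trans ih
  have below := const (τ.symm 0)
  have above := const (τ.symm (Fin.last k))
  simp only [Equiv.apply_symm_apply, Fin.val_zero, Fin.val_last] at below above
  omega

/-- the compact cube `[2, 2k²]^k` is stable under each map `F_τ`. -/
theorem stmt7 {k : ℕ} (hk : 1 ≤ k) (τ : Equiv.Perm (Fin (k + 1)))
    (l : Fin k → ℝ) (hl : ∀ i, l i ∈ Set.Icc (2 : ℝ) (2 * (k : ℝ) ^ 2)) :
    ∀ i, F τ i l ∈ Set.Icc (2 : ℝ) (2 * (k : ℝ) ^ 2) := by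
  intro i
  have lower : ∀ j, 2 ≤ Real.sqrt (2 * l j) := fun j =>
    Real.le_sqrt_of_sq_le (by linarith [(hl j).1])
  have upper : ∀ j, Real.sqrt (2 * l j) ≤ 2 * k := fun j =>
    Real.sqrt_le_iff.mpr ⟨by positivity, by linarith [(hl j).2]⟩
  constructor
  · obtain ⟨j, hj⟩ := Eset_nonempty τ i
    exact (lower j).trans
      (Finset.single_le_sum (f := fun j => Real.sqrt (2 * l j))
        (fun _ _ => Real.sqrt_nonneg _) hj)
  · calc F τ i l ≤ ∑ j : Fin k, Real.sqrt (2 * l j) :=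
          Finset.sum_le_sum_of_subset_of_nonneg (Finset.subset_univ _)
            fun _ _ _ => Real.sqrt_nonneg _
      _ ≤ ∑ _j : Fin k, 2 * (k : ℝ) := Finset.sum_le_sum fun j _ => upper j
      _ = 2 * (k : ℝ) ^ 2 := by
          rw [Finset.sum_const, Finset.card_univ, Fintype.card_fin, nsmul_eq_mul]
          ring
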